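/- arXiv:2307.00786 — 2 statements merged into one kernel-verified Lean document; each statement's English description precedes it below -/
import Mathlib

section
/- Let H = (V, A) be a finite directed graph with a source s ∈ V, a set P of unordered pairs of vertices (forbidden pairs), a set D ⊆ A of deletable arcs, and an integer k ≥ 0. Construct the directed graph H' with source s' and forbidden pairs P' as follows: for each u ∈ V add k+1 copies u^1,…,u^{k+1}; add a new vertex s' and arcs (s', s^1),…,(s', s^{k+1}); for each deletable arc (u,v) ∈ D add one new vertex m_{u,v}^1 with arcs (u^i, m_{u,v}^1) and (m_{u,v}^1, v^j) for all i, j ∈ [k+1]; for each undeletable arc (u,v) ∈ A \ D add k+1 new vertices m_{u,v}^1,…,m_{u,v}^{k+1} with arcs (u^i, m_{u,v}^l) and (m_{u,v}^l, v^j) for all i, j, l ∈ [k+1]; let P' = { {u^i, v^j} : {u,v} ∈ P, i, j ∈ [k+1] }. Then there exists F ⊆ D with |F| ≤ k such that, in H − F, s does not reach both vertices of any pair of P, if and only if there exists R ⊆ V(H') \ {s'} with |R| ≤ k such that, in H' − R (vertex deletion), s' does not reach both vertices of any pair of P'. -/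
open scoped Classical

universe u

/-- The vertices of the directed graph `H'` of the reduction from
Constrained Digraph Pair Cut to its vertex-deletion variant: a new source
`src = s'`, the copies `copy u i = uⁱ` of the original vertices, and the middle
vertices `mid u v l = m_{u,v}^l` of the arcs. -/
inductive DV (V : Type u) : Type u where
  | src : DV V
  | copy : V → ℕ → DV V
  | mid : V → V → ℕ → DV V
  deriving DecidableEq

variable {V : Type u} [DecidableEq V] [Fintype V]

/-- The arcs of `H'`, built from the arc set `A`, deletable arcs `D ⊆ A`,
source `s` and parameter `k`. -/
def liftArcs (A D : Set (V × V)) (s : V) (k : ℕ) : Set (DV V × DV V) :=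
  { a | (∃ i, 1 ≤ i ∧ i ≤ k + 1 ∧ a = (DV.src, DV.copy s i)) ∨
      (∃ u v, (u, v) ∈ D ∧ ∃ i, 1 ≤ i ∧ i ≤ k + 1 ∧
        (a = (DV.copy u i, DV.mid u v 1) ∨ a = (DV.mid u v 1, DV.copy v i))) ∨
      (∃ u v, (u, v) ∈ A ∧ (u, v) ∉ D ∧ ∃ i l, 1 ≤ i ∧ i ≤ k + 1 ∧
        1 ≤ l ∧ l ≤ k + 1 ∧
        (a = (DV.copy u i, DV.mid u v l) ∨ a = (DV.mid u v l, DV.copy v i))) }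

/-- The vertex set of `H'`. -/
def liftVerts (A D : Set (V × V)) (k : ℕ) : Set (DV V) :=
  { x | x = DV.src ∨ (∃ u i, 1 ≤ i ∧ i ≤ k + 1 ∧ x = DV.copy u i) ∨
      (∃ u v, (u, v) ∈ D ∧ x = DV.mid u v 1) ∨
      (∃ u v l, (u, v) ∈ A ∧ (u, v) ∉ D ∧ 1 ≤ l ∧ l ≤ k + 1 ∧
        x = DV.mid u v l) }

/-- The forbidden pairs `P'` of `H'`: all pairs `{uⁱ, vʲ}` of copies of a
forbidden pair `{u, v} ∈ P`. -/
def liftPairs (P : Set (V × V)) (k : ℕ) : Set (DV V × DV V) :=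
  { q | ∃ u v, (u, v) ∈ P ∧ ∃ i j, 1 ≤ i ∧ i ≤ k + 1 ∧ 1 ≤ j ∧ j ≤ k + 1 ∧
      q = (DV.copy u i, DV.copy v j) }

/-- Reachability by a directed path using the arcs of `A`. -/
def ReachArcs {α : Type*} (A : Set (α × α)) (x y : α) : Prop :=
  Relation.ReflTransGen (fun a b => (a, b) ∈ A) x y

/-- Reachability by a directed path using the arcs of `A` and avoiding the
deleted vertices `R`. -/
def ReachDel {α : Type*} (A : Set (α × α)) (R : Set α) (x y : α) : Prop :=
  Relation.ReflTransGen (fun a b => (a, b) ∈ A ∧ a ∉ R ∧ b ∉ R) x y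

/-- A set of at most `k` elements misses a value of an injective sequence on `{1, …, k + 1}`. -/
theorem exists_notMem_of_injective_of_card_le {α : Type*} {R : Finset α} {k : ℕ}
    (hR : R.card ≤ k) {f : ℕ → α} (hf : Function.Injective f) :
    ∃ i, 1 ≤ i ∧ i ≤ k + 1 ∧ f i ∉ R := by
  by_contra! h
  have hcard : (Finset.Icc 1 (k + 1)).card ≤ R.card :=
    Finset.card_le_card_of_injOn f
      (fun i hi => h i (Finset.mem_Icc.1 hi).1 (Finset.mem_Icc.1 hi).2) hf.injOn
  rw [Nat.card_Icc] at hcard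
  omega

/-- If `F` contains every deletable arc whose middle vertex is deleted, then every surviving copy of
a vertex reachable in `H - F` is reachable in `H' - R`. -/
theorem ReachArcs.reachDel_copy {W : Type*} {A D F : Set (W × W)} {s : W} {k : ℕ}
    {R : Finset (DV W)} (hR : R.card ≤ k) (hsrc : DV.src ∉ R)
    (hF : ∀ u v, (u, v) ∈ D → DV.mid u v 1 ∈ R → (u, v) ∈ F) {u : W}
    (h : ReachArcs (A \ F) s u) {i : ℕ} (hi : 1 ≤ i) (hik : i ≤ k + 1)
    (hu : DV.copy u i ∉ R) :
    ReachDel (liftArcs A D s k) R DV.src (DV.copy u i) := by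
  induction h generalizing i with
  | refl => exact .single ⟨.inl ⟨i, hi, hik, rfl⟩, hsrc, hu⟩
  | @tail b c _ hbc ih =>
    obtain ⟨j, hj, hjk, hb⟩ := exists_notMem_of_injective_of_card_le hR
      (f := DV.copy b) (fun _ _ h => by injection h)
    by_cases hD : (b, c) ∈ D
    · have hm : DV.mid b c 1 ∉ R := fun hm => hbc.2 (hF b c hD hm)
      exact ((ih hj hjk hb).tail ⟨.inr (.inl ⟨b, c, hD, j, hj, hjk, .inl rfl⟩), hb, hm⟩).tail
        ⟨.inr (.inl ⟨b, c, hD, i, hi, hik, .inr rfl⟩), hm, hu⟩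
    · obtain ⟨l, hl, hlk, hm⟩ := exists_notMem_of_injective_of_card_le hR
        (f := DV.mid b c) (fun _ _ h => by injection h)
      exact ((ih hj hjk hb).tail
        ⟨.inr (.inr ⟨b, c, hbc.1, hD, j, l, hj, hjk, hl, hlk, .inl rfl⟩), hb, hm⟩).tail
        ⟨.inr (.inr ⟨b, c, hbc.1, hD, i, l, hi, hik, hl, hlk, .inr rfl⟩), hm, hu⟩

/-- What reachability of a vertex of `H'` from `s'` says about the arc set `B` of `H - F`. -/
def ProjReach {W : Type*} (B : Set (W × W)) (s : W) : DV W → Prop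
  | .src => True
  | .copy u _ => ReachArcs B s u
  | .mid u v _ => ReachArcs B s u ∧ (u, v) ∈ B

/-- If the middle vertices of all arcs in `F ⊆ D` are deleted, then reachability in `H' - R`
projects to reachability in `H - F`. -/
theorem ReachDel.projReach {W : Type*} {A D F : Set (W × W)} (hDA : D ⊆ A) (hFD : F ⊆ D)
    {s : W} {k : ℕ} {R : Set (DV W)} (hR : ∀ u v, (u, v) ∈ F → DV.mid u v 1 ∈ R) {x : DV W}
    (h : ReachDel (liftArcs A D s k) R DV.src x) : ProjReach (A \ F) s x := by
  induction h with
  | refl => trivial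
  | tail _ hbc ih =>
    obtain ⟨harc, -, hc⟩ := hbc
    rcases harc with ⟨i, -, -, he⟩ | ⟨u, v, hD, i, -, -, he | he⟩ |
      ⟨u, v, hA, hD, i, l, -, -, -, -, he | he⟩ <;> obtain ⟨rfl, rfl⟩ := Prod.mk.inj he
    · exact .refl
    · exact ⟨ih, hDA hD, fun hF => hc (hR u v hF)⟩
    · exact ih.1.tail ih.2
    · exact ⟨ih, hA, fun hF => hD (hFD hF)⟩
    · exact ih.1.tail ih.2

/-- Constrained Digraph Pair Cut on `(H, s, P, D, k)` is equivalent to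
vertex-deletion Digraph Pair Cut on the constructed instance `(H', s', P', k)`. -/
theorem constrainedPairCut_iff_vertexDeletion (A D : Finset (V × V)) (hDA : D ⊆ A)
    (s : V) (P : Set (V × V)) (k : ℕ) :
    (∃ F : Finset (V × V), F ⊆ D ∧ F.card ≤ k ∧
      ∀ p ∈ P, ¬(ReachArcs (↑A \ ↑F : Set (V × V)) s p.1 ∧
        ReachArcs (↑A \ ↑F : Set (V × V)) s p.2)) ↔
    (∃ R : Finset (DV V), ↑R ⊆ liftVerts (↑A : Set (V × V)) ↑D k \ {DV.src} ∧
      R.card ≤ k ∧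
      ∀ q ∈ liftPairs P k,
        ¬(ReachDel (liftArcs (↑A : Set (V × V)) ↑D s k) ↑R DV.src q.1 ∧
          ReachDel (liftArcs (↑A : Set (V × V)) ↑D s k) ↑R DV.src q.2)) := by
  constructor
  · rintro ⟨F, hFD, hFk, hF⟩
    refine ⟨F.image fun a => DV.mid a.1 a.2 1, ?_, Finset.card_image_le.trans hFk, ?_⟩
    · intro x hx
      obtain ⟨a, ha, rfl⟩ := Finset.mem_image.1 (Finset.mem_coe.1 hx)
      exact ⟨.inr (.inr (.inl ⟨a.1, a.2, hFD ha, rfl⟩)), nofun⟩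
    · rintro _ ⟨u, v, huv, i, j, -, -, -, -, rfl⟩ ⟨hu, hv⟩
      have hR : ∀ u v, (u, v) ∈ (F : Set (V × V)) →
          DV.mid u v 1 ∈ ((F.image fun a => DV.mid a.1 a.2 1 : Finset (DV V)) : Set (DV V)) :=
        fun u v h => Finset.mem_coe.2 (Finset.mem_image.2 ⟨(u, v), h, rfl⟩)
      exact hF _ huv ⟨hu.projReach (Finset.coe_subset.2 hDA) (Finset.coe_subset.2 hFD) hR,
        hv.projReach (Finset.coe_subset.2 hDA) (Finset.coe_subset.2 hFD) hR⟩
  · rintro ⟨R, hRV, hRk, hR⟩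
    have hsrc : DV.src ∉ R := fun h => (hRV (Finset.mem_coe.2 h)).2 rfl
    refine ⟨D.filter fun a => DV.mid a.1 a.2 1 ∈ R, Finset.filter_subset _ _, ?_, ?_⟩
    · refine (Finset.card_le_card_of_injOn (fun a : V × V => DV.mid a.1 a.2 1)
        (fun a ha => (Finset.mem_filter.1 ha).2) ?_).trans hRk
      rintro ⟨a, b⟩ - ⟨c, d⟩ - h
      injection h with h₁ h₂
      exact Prod.ext h₁ h₂
    · rintro ⟨u, v⟩ huv ⟨hu, hv⟩
      have hF : ∀ u v, (u, v) ∈ (D : Set (V × V)) → DV.mid u v 1 ∈ R →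
          (u, v) ∈ ((D.filter fun a => DV.mid a.1 a.2 1 ∈ R : Finset (V × V)) : Set (V × V)) :=
        fun u v hD hm => Finset.mem_coe.2 (Finset.mem_filter.2 ⟨hD, hm⟩)
      obtain ⟨i, hi, hik, hiR⟩ := exists_notMem_of_injective_of_card_le hRk
        (f := DV.copy u) (fun _ _ h => by injection h)
      obtain ⟨j, hj, hjk, hjR⟩ := exists_notMem_of_injective_of_card_le hRk
        (f := DV.copy v) (fun _ _ h => by injection h)
      exact hR _ ⟨u, v, huv, i, j, hi, hik, hj, hjk, rfl⟩
        ⟨hu.reachDel_copy hRk hsrc hF hi hik hiR, hv.reachDel_copy hRk hsrc hF hj hjk hjR⟩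
end

section
/- Let H = (V, A) be a finite directed graph with source s, forbidden pairs P, deletable arcs D ⊆ A, and integer k ≥ 0, and let H', s', P' be the vertex-deletion instance constructed from (H, s, P, D, k) as described. If there exists R ⊆ V(H') \ {s'} with |R| ≤ k such that, in H' − R, s' does not reach both vertices of any pair of P', then there exists such a set R' with |R'| ≤ |R| consisting only of vertices of the form m_{u,v}^1 with (u, v) ∈ D; that is, one may assume the solution deletes no copy u^i of an original vertex and no middle vertex of an undeletable arc. -/
open scoped Classical

universe u

variable {V : Type u} [DecidableEq V] [Fintype V]

/-- A set of at most `k` elements misses one of any `k + 1` distinct elements. -/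
theorem exists_index_notMem {α : Type*} {f : ℕ → α} (hf : Function.Injective f) {k : ℕ}
    {R : Finset α} (hR : R.card ≤ k) : ∃ i, 1 ≤ i ∧ i ≤ k + 1 ∧ f i ∉ R := by
  by_contra! h
  have hsub : (Finset.Icc 1 (k + 1)).image f ⊆ R := by
    intro x hx
    obtain ⟨i, hi, rfl⟩ := Finset.mem_image.mp hx
    exact h i (Finset.mem_Icc.mp hi).1 (Finset.mem_Icc.mp hi).2
  have hcard := Finset.card_le_card hsub
  rw [Finset.card_image_of_injective _ hf, Nat.card_Icc] at hcard
  omega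

theorem copy_injective {V : Type*} (u : V) : Function.Injective (DV.copy u) :=
  fun _ _ h => by injection h

theorem mid_injective {V : Type*} (u v : V) : Function.Injective (DV.mid u v) :=
  fun _ _ h => by injection h

/-- Every surviving twin of `x` is reachable from the source after deleting `R`. The twins of a
copy are the copies of the same vertex, those of a middle vertex the middle vertices of the same
arc. -/
def TwinsReached {V : Type*} (A D : Set (V × V)) (s : V) (k : ℕ) (R : Set (DV V)) : DV V → Prop
  | DV.src => True
  | DV.copy u _ => ∀ i, 1 ≤ i → i ≤ k + 1 → DV.copy u i ∉ R →
      ReachDel (liftArcs A D s k) R DV.src (DV.copy u i)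
  | DV.mid u v _ => ∀ l, 1 ≤ l → l ≤ k + 1 → ((u, v) ∈ D → l = 1) → DV.mid u v l ∉ R →
      ReachDel (liftArcs A D s k) R DV.src (DV.mid u v l)

/-- If `R'` contains every deletable middle vertex of `R`, then deleting `R` instead of `R'` keeps
the surviving twins of all reachable vertices reachable. -/
theorem ReachDel.twinsReached {V : Type*} {A D : Set (V × V)} {s : V} {k : ℕ}
    {R : Finset (DV V)} {R' : Set (DV V)} (hsrc : DV.src ∉ R) (hR : R.card ≤ k)
    (hR' : ∀ u v, (u, v) ∈ D → DV.mid u v 1 ∈ R → DV.mid u v 1 ∈ R') {x : DV V}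
    (hx : ReachDel (liftArcs A D s k) R' DV.src x) : TwinsReached A D s k R x := by
  induction hx with
  | refl => trivial
  | tail _ hstep ih =>
    obtain ⟨harc, hb, -⟩ := hstep
    rcases harc with ⟨i, -, -, h⟩ | ⟨u, v, hD, i, -, -, h | h⟩ |
      ⟨u, v, hA, hD, i, l, -, -, -, -, h | h⟩ <;> obtain ⟨rfl, rfl⟩ := Prod.mk.inj h
    · intro j h1 h2 hj
      exact .single ⟨.inl ⟨j, h1, h2, rfl⟩, hsrc, hj⟩
    · intro l _ _ hl hlR
      obtain rfl := hl hD
      obtain ⟨j, h1, h2, hj⟩ := exists_index_notMem (copy_injective u) hR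
      exact (ih j h1 h2 hj).tail ⟨.inr (.inl ⟨u, v, hD, j, h1, h2, .inl rfl⟩), hj, hlR⟩
    · intro j h1 h2 hj
      have hm : DV.mid u v 1 ∉ R := fun hm => hb (hR' u v hD hm)
      exact (ih 1 le_rfl (by omega) (fun _ => rfl) hm).tail
        ⟨.inr (.inl ⟨u, v, hD, j, h1, h2, .inr rfl⟩), hm, hj⟩
    · intro m hm1 hm2 _ hm
      obtain ⟨j, h1, h2, hj⟩ := exists_index_notMem (copy_injective u) hR
      exact (ih j h1 h2 hj).tail
        ⟨.inr (.inr ⟨u, v, hA, hD, j, m, h1, h2, hm1, hm2, .inl rfl⟩), hj, hm⟩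
    · intro j h1 h2 hj
      obtain ⟨m, hm1, hm2, hm⟩ := exists_index_notMem (mid_injective u v) hR
      exact (ih m hm1 hm2 (fun h => absurd h hD) hm).tail
        ⟨.inr (.inr ⟨u, v, hA, hD, j, m, h1, h2, hm1, hm2, .inr rfl⟩), hm, hj⟩

/-- Any vertex-deletion solution of the constructed instance can be replaced by
one of no larger size consisting only of middle vertices `m_{u,v}¹` of deletable
arcs `(u, v) ∈ D`. -/
theorem vertexDeletion_solution_normalize (A D : Finset (V × V)) (hDA : D ⊆ A)
    (s : V) (P : Set (V × V)) (k : ℕ)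
    (R : Finset (DV V))
    (hRsub : ↑R ⊆ liftVerts (↑A : Set (V × V)) ↑D k \ {DV.src})
    (hRcard : R.card ≤ k)
    (hRsol : ∀ q ∈ liftPairs P k,
      ¬(ReachDel (liftArcs (↑A : Set (V × V)) ↑D s k) ↑R DV.src q.1 ∧
        ReachDel (liftArcs (↑A : Set (V × V)) ↑D s k) ↑R DV.src q.2)) :
    ∃ R' : Finset (DV V), R'.card ≤ R.card ∧
      (↑R' ⊆ { x : DV V | ∃ u v, (u, v) ∈ D ∧ x = DV.mid u v 1 }) ∧
      ∀ q ∈ liftPairs P k,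
        ¬(ReachDel (liftArcs (↑A : Set (V × V)) ↑D s k) ↑R' DV.src q.1 ∧
          ReachDel (liftArcs (↑A : Set (V × V)) ↑D s k) ↑R' DV.src q.2) := by
  have hsrc : DV.src ∉ R := fun h => (hRsub h).2 rfl
  refine ⟨R.filter fun x => ∃ u v, (u, v) ∈ D ∧ x = DV.mid u v 1,
    Finset.card_filter_le _ _, fun x hx => (Finset.mem_filter.mp hx).2, ?_⟩
  rintro _ ⟨u, v, huv, i, j, -, -, -, -, rfl⟩ ⟨hu, hv⟩
  have hkeep : ∀ a b, (a, b) ∈ (↑D : Set (V × V)) → DV.mid a b 1 ∈ R → DV.mid a b 1 ∈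
      (↑(R.filter fun x => ∃ u v, (u, v) ∈ D ∧ x = DV.mid u v 1) : Set (DV V)) :=
    fun a b hab hm => Finset.mem_filter.mpr ⟨hm, a, b, hab, rfl⟩
  obtain ⟨i', hi1, hi2, hi⟩ := exists_index_notMem (copy_injective u) hRcard
  obtain ⟨j', hj1, hj2, hj⟩ := exists_index_notMem (copy_injective v) hRcard
  exact hRsol _ ⟨u, v, huv, i', j', hi1, hi2, hj1, hj2, rfl⟩
    ⟨hu.twinsReached hsrc hRcard hkeep i' hi1 hi2 hi,
      hv.twinsReached hsrc hRcard hkeep j' hj1 hj2 hj⟩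
end
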